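/- If a digraph G satisfies condition L3 or condition L4, then G is not (≤6)-half-reconstructible. -/

import Mathlib

universe u v

/-- A digraph: an irreflexive binary relation on a vertex type. -/
structure Dgraph (V : Type u) where
  Arc : V → V → Prop
  irrefl : ∀ x, ¬ Arc x x

namespace Dgraph

variable {V : Type u} {W : Type v}

/-- The dual digraph. -/
def dual (G : Dgraph V) : Dgraph V :=
  ⟨fun x y => G.Arc y x, fun x h => G.irrefl x h⟩

/-- Subdigraph induced by a set of vertices. -/
def ind (G : Dgraph V) (X : Set V) : Dgraph X :=
  ⟨fun x y => G.Arc x y, fun x h => G.irrefl x h⟩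

/-- Isomorphism of digraphs. -/
def Iso (G : Dgraph V) (G' : Dgraph W) : Prop :=
  ∃ e : V ≃ W, ∀ x y, G.Arc x y ↔ G'.Arc (e x) (e y)

/-- `G` and `G'` are hemimorphic: `G'` is isomorphic to `G` or to its dual. -/
def Hemi (G : Dgraph V) (G' : Dgraph W) : Prop :=
  Iso G G' ∨ Iso G.dual G'

/-- Self-dual digraph. -/
def SelfDual (G : Dgraph V) : Prop := Iso G G.dual

/-- `{x,y}` is a directed pair. -/
def Dir (G : Dgraph V) (x y : V) : Prop :=
  (G.Arc x y ∧ ¬ G.Arc y x) ∨ (G.Arc y x ∧ ¬ G.Arc x y)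

/-- `{x,y}` is a neutral pair (full or void). -/
def Neutral (G : Dgraph V) (x y : V) : Prop :=
  x ≠ y ∧ ¬ G.Dir x y

/-- Interval of a digraph. -/
def IsInterval (G : Dgraph V) (I : Set V) : Prop :=
  ∀ x ∉ I,
    (∀ y ∈ I, G.Arc x y ∧ ¬ G.Arc y x) ∨ (∀ y ∈ I, G.Arc y x ∧ ¬ G.Arc x y) ∨
    (∀ y ∈ I, G.Arc x y ∧ G.Arc y x) ∨ (∀ y ∈ I, ¬ G.Arc x y ∧ ¬ G.Arc y x)

/-- The arc-connectivity equivalence relation. -/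
def ACRel (G : Dgraph V) : V → V → Prop := Relation.ReflTransGen G.Dir

/-- Arc-connected components. -/
def IsACComponent (G : Dgraph V) (D : Set V) : Prop :=
  ∃ x, D = {y | G.ACRel x y}

/-- Arc-connected digraph (at most one arc-connected component). -/
def ArcConnected (G : Dgraph V) : Prop := ∀ x y, G.ACRel x y

/-- Tournament. -/
def IsTournament (G : Dgraph V) : Prop := ∀ x y, x ≠ y → G.Dir x y

/-- Chain (transitive tournament). -/
def IsChainD (G : Dgraph V) : Prop :=
  G.IsTournament ∧ ∀ x y z, G.Arc x y → G.Arc y z → G.Arc x z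

/-- Dgraph from a relation, with forced irreflexivity. -/
def ofRel (r : V → V → Prop) : Dgraph V := ⟨fun x y => x ≠ y ∧ r x y, fun x h => h.1 rfl⟩

/-- The model flag. -/
def flagD : Dgraph (Fin 3) :=
  ofRel (fun x y => (x = 0 ∧ y = 1) ∨ (x = 1 ∧ y = 2) ∨ (x = 2 ∧ y = 1))

/-- First model peak. -/
def peakD1 : Dgraph (Fin 3) :=
  ofRel (fun x y => (x = 0 ∧ y = 1) ∨ (x = 0 ∧ y = 2) ∨ (x = 1 ∧ y = 2) ∨ (x = 2 ∧ y = 1))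

/-- Second model peak. -/
def peakD2 : Dgraph (Fin 3) :=
  ofRel (fun x y => (x = 0 ∧ y = 1) ∨ (x = 0 ∧ y = 2))

/-- The model diamond. -/
def diamondD : Dgraph (Fin 4) :=
  ofRel (fun x y => (x = 0 ∧ y = 1) ∨ (x = 0 ∧ y = 2) ∨ (x = 0 ∧ y = 3) ∨
    (x = 1 ∧ y = 2) ∨ (x = 2 ∧ y = 3) ∨ (x = 3 ∧ y = 1))

/-- A flag is a digraph hemimorphic to the model flag. -/
def IsFlag (G : Dgraph V) : Prop := Hemi G flagD

/-- A peak is a digraph hemimorphic to one of the two model peaks. -/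
def IsPeak (G : Dgraph V) : Prop := Hemi G peakD1 ∨ Hemi G peakD2

/-- A diamond is a digraph hemimorphic to the model diamond. -/
def IsDiamond (G : Dgraph V) : Prop := Hemi G diamondD

/-- Prechain: embeds no peak, no diamond, no two adjacent neutral pairs. -/
def IsPrechain (G : Dgraph V) : Prop :=
  (∀ X : Set V, ¬ IsPeak (G.ind X)) ∧ (∀ X : Set V, ¬ IsDiamond (G.ind X)) ∧
  ¬ ∃ x y z : V, y ≠ z ∧ G.Neutral x y ∧ G.Neutral x z

/-- Proper prechain: a prechain which is not a chain. -/
def ProperPrechain (G : Dgraph V) : Prop := G.IsPrechain ∧ ¬ G.IsChainD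

/-- Diamond-free tournament. -/
def DiamondFreeTournament (G : Dgraph V) : Prop :=
  G.IsTournament ∧ ∀ X : Set V, ¬ IsDiamond (G.ind X)

/-- Non-tournament prechain. -/
def NonTournamentPrechain (G : Dgraph V) : Prop := G.IsPrechain ∧ ¬ G.IsTournament

/-- Model finite consecutivity on `n` vertices (`full` decides whether the
non-consecutive pairs are all full or all void). -/
def consecFin (n : ℕ) (full : Bool) : Dgraph (Fin n) :=
  ofRel (fun i j => i.1 + 1 = j.1 ∨ (full = true ∧ (i.1 + 1 < j.1 ∨ j.1 + 1 < i.1)))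

/-- Model consecutivity of type ω. -/
def consecNat (full : Bool) : Dgraph ℕ :=
  ofRel (fun i j => i + 1 = j ∨ (full = true ∧ (i + 1 < j ∨ j + 1 < i)))

/-- Model consecutivity of type ω*+ω. -/
def consecInt (full : Bool) : Dgraph ℤ :=
  ofRel (fun i j => i + 1 = j ∨ (full = true ∧ (i + 1 < j ∨ j + 1 < i)))

/-- One-end infinite consecutivity (obtained from ω or ω*). -/
def OneEndInfiniteConsecutivity (G : Dgraph V) : Prop :=
  ∃ full, Iso G (consecNat full) ∨ Iso G (consecNat full).dual

/-- Consecutivity. -/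
def IsConsecutivity (G : Dgraph V) : Prop :=
  (∃ n, 3 ≤ n ∧ ∃ full, Iso G (consecFin n full)) ∨
  G.OneEndInfiniteConsecutivity ∨ (∃ full, Iso G (consecInt full))

/-- Model cycle on `n ≥ 3` vertices obtained from the finite consecutivity by
replacing the neutral pair `{0, n-1}` by the arc `(n-1, 0)`. -/
def cycleD (n : ℕ) (full : Bool) : Dgraph (Fin n) :=
  ofRel (fun i j => i.1 + 1 = j.1 ∨ (i.1 = n - 1 ∧ j.1 = 0) ∨
    (full = true ∧ (i.1 + 1 < j.1 ∨ j.1 + 1 < i.1) ∧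
      ¬ (i.1 = 0 ∧ j.1 = n - 1) ∧ ¬ (i.1 = n - 1 ∧ j.1 = 0)))

/-- Cycle. -/
def IsCycle (G : Dgraph V) : Prop := ∃ n, 3 ≤ n ∧ ∃ full, Iso G (cycleD n full)

/-- Near-chain: obtained from a chain by exchanging the directed pair formed
by its extremities. -/
def IsNearChain (G : Dgraph V) : Prop :=
  ∃ (H : Dgraph V) (m M : V), H.IsChainD ∧ m ≠ M ∧
    (∀ x, x ≠ m → H.Arc m x) ∧ (∀ x, x ≠ M → H.Arc x M) ∧
    (∀ x y, G.Arc x y ↔ ((H.Arc x y ∧ ¬ (x = m ∧ y = M)) ∨ (x = M ∧ y = m)))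

/-- `{k}`-hypomorphy. -/
def KHypo (k : ℕ) (G G' : Dgraph V) : Prop :=
  ∀ X : Set V, X.Finite → X.ncard = k → Iso (G.ind X) (G'.ind X)

/-- `(≤ k)`-hypomorphy. -/
def LeHypo (k : ℕ) (G G' : Dgraph V) : Prop :=
  ∀ j, 1 ≤ j → j ≤ k → KHypo j G G'

/-- `{k}`-hemimorphy. -/
def KHemi (k : ℕ) (G G' : Dgraph V) : Prop :=
  ∀ X : Set V, X.Finite → X.ncard = k → Hemi (G.ind X) (G'.ind X)

/-- `(≤ k)`-hemimorphy. -/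
def LeHemi (k : ℕ) (G G' : Dgraph V) : Prop :=
  ∀ j, 1 ≤ j → j ≤ k → KHemi j G G'

/-- `(≤ k)`-half-reconstructibility. -/
def HalfRecon (k : ℕ) (G : Dgraph V) : Prop :=
  ∀ G' : Dgraph V, LeHemi k G G' → Hemi G G'

/-- One step of the difference relation. -/
def DiffStep (G G' : Dgraph V) (x y : V) : Prop := G.Arc x y ↔ ¬ G'.Arc x y

/-- The difference relation `𝔇_{G,G'}`. -/
def DiffRel (G G' : Dgraph V) (x y : V) : Prop :=
  x = y ∨ Relation.TransGen (DiffStep G G') x y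

/-- Difference classes: `C ∈ D_{G,G'}`. -/
def DiffClass (G G' : Dgraph V) (C : Set V) : Prop :=
  ∃ x, C = {y | DiffRel G G' x y}

/-- The difference relation has at least two equivalence classes. -/
def AtLeastTwoDiffClasses (G G' : Dgraph V) : Prop :=
  ∃ C₁ C₂ : Set V, DiffClass G G' C₁ ∧ DiffClass G G' C₂ ∧ C₁ ≠ C₂

/-- `C_dual(G)`: the smallest cardinality of a finite set of vertices inducing a
non-self-dual subdigraph (`⊤` if there is none). -/
noncomputable def Cdual (G : Dgraph V) : ℕ∞ :=
  sInf {n : ℕ∞ | ∃ X : Set V, X.Finite ∧ ¬ SelfDual (G.ind X) ∧ n = (X.ncard : ℕ∞)}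

/-- The contracted digraph `G_I` (the vertex `none` plays the role of `I`). -/
def contract (G : Dgraph V) (I : Set V) : Dgraph (Option {x : V // x ∉ I}) where
  Arc := fun a b =>
    match a, b with
    | some x, some y => G.Arc x.1 y.1
    | some x, none => ∃ z ∈ I, G.Arc x.1 z
    | none, some y => ∃ z ∈ I, G.Arc z y.1
    | none, none => False
  irrefl := by
    rintro (_ | ⟨x, hx⟩)
    · simp
    · exact G.irrefl x

/-- There is an isomorphism `f` from `G_I` onto `G'_I` with `f(I) = I`. -/
def ContractIsoFix (G G' : Dgraph V) (I : Set V) : Prop :=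
  ∃ e : Option {x : V // x ∉ I} ≃ Option {x : V // x ∉ I},
    e none = none ∧ ∀ a b, (G.contract I).Arc a b ↔ (G'.contract I).Arc (e a) (e b)

/-- `D` is disjoint from every flag of `G`. -/
def FlagDisjoint (G : Dgraph V) (D : Set V) : Prop :=
  ∀ F : Set V, IsFlag (G.ind F) → D ∩ F = ∅

/-- `D` contains a vertex `a` of a flag `{a,b,c}` of `G` with `b, c ∉ D` and
`{b,c}` the directed pair of the flag. -/
def FlagVertexCond (G : Dgraph V) (D : Set V) : Prop :=
  ∃ a ∈ D, ∃ b c : V, b ∉ D ∧ c ∉ D ∧ IsFlag (G.ind {a, b, c}) ∧ G.Dir b c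

/-- Condition `C_∞`. -/
def CondCinf (G : Dgraph V) : Prop :=
  (∃ I : Set V, I.Infinite ∧ G.IsInterval I ∧ (G.ind I).IsChainD) ∨
  (∃ I J : Set V, I ≠ J ∧ G.IsInterval I ∧ G.IsInterval J ∧
     (G.ind I).OneEndInfiniteConsecutivity ∧ (G.ind J).OneEndInfiniteConsecutivity) ∨
  (∃ I : Set V, G.IsInterval I ∧ (G.ind I).OneEndInfiniteConsecutivity ∧
     (∀ J : Set V, G.IsInterval J → (G.ind J).OneEndInfiniteConsecutivity → J = I) ∧
     ¬ ContractIsoFix G G.dual I)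

/-- The kind of component occurring in conditions `K1` and `K2`. -/
def K12Kind (G : Dgraph V) (D : Set V) : Prop :=
  DiamondFreeTournament (G.ind D) ∨ (NonTournamentPrechain (G.ind D) ∧ G.FlagDisjoint D)

/-- Condition `K1`. -/
def CondK1 (G : Dgraph V) : Prop :=
  G.Cdual = 3 ∧ ∃ D₁ D₂ : Set V, D₁ ≠ D₂ ∧
    (G.IsACComponent D₁ ∧ ¬ SelfDual (G.ind D₁) ∧ G.IsInterval D₁ ∧ G.K12Kind D₁) ∧
    (G.IsACComponent D₂ ∧ ¬ SelfDual (G.ind D₂) ∧ G.IsInterval D₂ ∧ G.K12Kind D₂)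

/-- Condition `K2`. -/
def CondK2 (G : Dgraph V) : Prop :=
  G.Cdual = 3 ∧ ∃ D₀ : Set V, G.IsACComponent D₀ ∧ ¬ SelfDual (G.ind D₀) ∧
    (∀ D, G.IsACComponent D → ¬ SelfDual (G.ind D) → D = D₀) ∧
    G.K12Kind D₀ ∧ ¬ ContractIsoFix G G.dual D₀

/-- Condition `K3`. -/
def CondK3 (G : Dgraph V) : Prop :=
  G.Cdual = 4 ∧ ∃ D₁ D₂ : Set V, D₁ ≠ D₂ ∧
    (G.IsACComponent D₁ ∧ ¬ SelfDual (G.ind D₁) ∧ G.IsInterval D₁) ∧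
    (G.IsACComponent D₂ ∧ ¬ SelfDual (G.ind D₂) ∧ G.IsInterval D₂)

/-- Condition `K4`. -/
def CondK4 (G : Dgraph V) : Prop :=
  G.Cdual = 5 ∧ ∃ D₁ D₂ : Set V, D₁ ≠ D₂ ∧
    (G.IsACComponent D₁ ∧ ¬ SelfDual (G.ind D₁) ∧ G.IsInterval D₁ ∧ IsPrechain (G.ind D₁)) ∧
    (G.IsACComponent D₂ ∧ ¬ SelfDual (G.ind D₂) ∧ G.IsInterval D₂ ∧ IsPrechain (G.ind D₂))

/-- Condition `K5`. -/
def CondK5 (G : Dgraph V) : Prop :=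
  G.Cdual = 6 ∧ ∃ D₁ D₂ : Set V, D₁ ≠ D₂ ∧
    (G.IsACComponent D₁ ∧ ¬ SelfDual (G.ind D₁) ∧ G.IsInterval D₁ ∧
      DiamondFreeTournament (G.ind D₁)) ∧
    (G.IsACComponent D₂ ∧ ¬ SelfDual (G.ind D₂) ∧ G.IsInterval D₂ ∧
      DiamondFreeTournament (G.ind D₂))

/-- The kind of interval occurring in conditions `L1` and `L2`. -/
def L12Int (G : Dgraph V) (I : Set V) : Prop :=
  G.IsInterval I ∧ DiamondFreeTournament (G.ind I) ∧ ¬ SelfDual (G.ind I) ∧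
    ¬ G.IsACComponent I

/-- Condition `L1`. -/
def CondL1 (G : Dgraph V) : Prop :=
  ∃ I₁ I₂ : Set V, I₁ ≠ I₂ ∧ G.L12Int I₁ ∧ G.L12Int I₂

/-- Condition `L2`. -/
def CondL2 (G : Dgraph V) : Prop :=
  ∃ I₀ : Set V, G.L12Int I₀ ∧ (∀ I, G.L12Int I → I = I₀) ∧ ¬ ContractIsoFix G G.dual I₀

/-- Condition `L3`. -/
def CondL3 (G : Dgraph V) : Prop :=
  G.Cdual = 3 ∧ ∃ D₁ D₂ : Set V, D₁ ≠ D₂ ∧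
    (G.IsACComponent D₁ ∧ ¬ SelfDual (G.ind D₁) ∧ G.IsInterval D₁) ∧
    (G.IsACComponent D₂ ∧ ¬ SelfDual (G.ind D₂) ∧ G.IsInterval D₂) ∧
    ((G.FlagDisjoint D₁ ∧ Cdual (G.ind D₁) = 4 ∧ G.FlagDisjoint D₂ ∧ Cdual (G.ind D₂) = 4) ∨
     (NonTournamentPrechain (G.ind D₁) ∧ G.FlagVertexCond D₁ ∧
      NonTournamentPrechain (G.ind D₂) ∧ G.FlagVertexCond D₂))

/-- Condition `L4`. -/
def CondL4 (G : Dgraph V) : Prop :=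
  G.Cdual = 3 ∧ ∃ D₀ : Set V, G.IsACComponent D₀ ∧ ¬ SelfDual (G.ind D₀) ∧
    (∀ D, G.IsACComponent D → ¬ SelfDual (G.ind D) → D = D₀) ∧
    G.IsInterval D₀ ∧
    ((G.FlagDisjoint D₀ ∧ Cdual (G.ind D₀) = 4) ∨
     (NonTournamentPrechain (G.ind D₀) ∧ G.FlagVertexCond D₀)) ∧
    ¬ ContractIsoFix G G.dual D₀

end Dgraph

namespace Dgraph

variable {V : Type*} {W : Type*} {U : Type*}

section Basic

variable {G : Dgraph V} {H : Dgraph W} {K : Dgraph U}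

theorem Iso.refl (G : Dgraph V) : Iso G G := ⟨Equiv.refl V, fun _ _ => Iff.rfl⟩

theorem Iso.symm (h : Iso G H) : Iso H G := by
  obtain ⟨e, he⟩ := h
  exact ⟨e.symm, fun x y => by simp [he]⟩

theorem Iso.trans (h : Iso G H) (h' : Iso H K) : Iso G K := by
  obtain ⟨e, he⟩ := h
  obtain ⟨f, hf⟩ := h'
  exact ⟨e.trans f, fun x y => by simp [he, hf]⟩

theorem Iso.dual (h : Iso G H) : Iso G.dual H.dual := by
  obtain ⟨e, he⟩ := h
  exact ⟨e, fun _ _ => he _ _⟩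

theorem SelfDual.of_iso (hG : SelfDual G) (h : Iso G H) : SelfDual H :=
  (h.symm.trans hG).trans h.dual

theorem SelfDual.dual (hG : SelfDual G) : SelfDual G.dual := Iso.dual hG

theorem Hemi.symm (h : Hemi G H) : Hemi H G :=
  h.imp Iso.symm fun h => h.dual.symm

theorem Hemi.trans (h : Hemi G H) (h' : Hemi H K) : Hemi G K := by
  rcases h with h | h <;> rcases h' with h' | h'
  · exact .inl (h.trans h')
  · exact .inr (h.dual.trans h')
  · exact .inr (h.trans h')
  · exact .inl (h.dual.trans h')

theorem iso_ind_image (e : V ≃ W) (he : ∀ x y, G.Arc x y ↔ H.Arc (e x) (e y)) (Y : Set V) :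
    Iso (G.ind Y) (H.ind (e '' Y)) :=
  ⟨e.image Y, fun x y => he x y⟩

theorem iso_ind_ind (G : Dgraph V) (D : Set V) (Y : Set D) :
    Iso ((G.ind D).ind Y) (G.ind (Subtype.val '' Y)) :=
  ⟨Equiv.Set.image _ Y Subtype.val_injective, fun _ _ => Iff.rfl⟩

theorem iso_ind_range {f : W → V} (hf : Function.Injective f)
    (h : ∀ i j, H.Arc i j ↔ G.Arc (f i) (f j)) : Iso (G.ind (Set.range f)) H :=
  Iso.symm ⟨Equiv.ofInjective f hf, h⟩

theorem iso_ind_of_perm {G H : Dgraph V} {X : Set V} (σ : Equiv.Perm V)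
    (hX : ∀ x, x ∈ X ↔ σ x ∈ X)
    (h : ∀ x ∈ X, ∀ y ∈ X, G.Arc x y ↔ H.Arc (σ x) (σ y)) : Iso (G.ind X) (H.ind X) :=
  ⟨σ.subtypeEquiv hX, fun x y => h x x.2 y y.2⟩

theorem SelfDual.exists_perm {G : Dgraph V} {Y : Set V} (h : SelfDual (G.ind Y)) :
    ∃ σ : Equiv.Perm V, (∀ x, x ∈ Y ↔ σ x ∈ Y) ∧ (∀ x ∉ Y, σ x = x) ∧
      ∀ x ∈ Y, ∀ y ∈ Y, G.Arc x y ↔ G.Arc (σ y) (σ x) := by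
  classical
  obtain ⟨e, he⟩ := h
  have hin : ∀ x (hx : x ∈ Y), Equiv.Perm.ofSubtype e x = e ⟨x, hx⟩ := fun x hx =>
    Equiv.Perm.ofSubtype_apply_of_mem e hx
  have hout : ∀ x ∉ Y, Equiv.Perm.ofSubtype e x = x := fun x hx =>
    Equiv.Perm.ofSubtype_apply_of_not_mem e hx
  refine ⟨Equiv.Perm.ofSubtype e, fun x => ?_, hout, fun x hx y hy => ?_⟩
  · by_cases hx : x ∈ Y
    · simp [hin x hx, hx]
    · simp [hout x hx, hx]
  · rw [hin x hx, hin y hy]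
    exact he ⟨x, hx⟩ ⟨y, hy⟩

/-- A permutation of the indices that reverses all arcs makes the listed vertices self-dual. -/
theorem selfDual_ind_range {f : W → V} (hf : Function.Injective f) (τ : Equiv.Perm W)
    (h : ∀ i j, G.Arc (f i) (f j) ↔ G.Arc (f (τ j)) (f (τ i))) :
    SelfDual (G.ind (Set.range f)) := by
  let H : Dgraph W := ⟨fun i j => G.Arc (f i) (f j), fun i => G.irrefl _⟩
  have hH : SelfDual H := ⟨τ, h⟩
  exact hH.of_iso (iso_ind_range (G := G) hf fun _ _ => Iff.rfl).symm

theorem Dir.symm {G : Dgraph V} {x y : V} (h : G.Dir x y) : G.Dir y x := Or.symm h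

theorem arc_comm_of_not_dir {G : Dgraph V} {x y : V} (h : ¬ G.Dir x y) :
    G.Arc x y ↔ G.Arc y x := by
  unfold Dir at h
  tauto

theorem acRel_equivalence (G : Dgraph V) : Equivalence G.ACRel where
  refl _ := .refl
  symm h := by
    induction h with
    | refl => exact .refl
    | tail _ h ih => exact .head h.symm ih
  trans := .trans

theorem IsACComponent.mem_of_dir {G : Dgraph V} {D : Set V} (hD : G.IsACComponent D) {x y : V}
    (hx : x ∈ D) (h : G.Dir x y) : y ∈ D := by
  obtain ⟨c, rfl⟩ := hD
  exact Relation.ReflTransGen.tail hx h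

theorem IsACComponent.eq_of_mem {G : Dgraph V} {D : Set V} (hD : G.IsACComponent D) {x : V}
    (hx : x ∈ D) : D = {y | G.ACRel x y} := by
  obtain ⟨c, rfl⟩ := hD
  ext y
  exact ⟨fun hy => G.acRel_equivalence.trans (G.acRel_equivalence.symm hx) hy,
    fun hy => G.acRel_equivalence.trans hx hy⟩

theorem IsACComponent.eq_of_mem_of_mem {G : Dgraph V} {D E : Set V} (hD : G.IsACComponent D)
    (hE : G.IsACComponent E) {x : V} (hxD : x ∈ D) (hxE : x ∈ E) : D = E := by
  rw [hD.eq_of_mem hxD, hE.eq_of_mem hxE]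

theorem IsACComponent.not_dir {G : Dgraph V} {D : Set V} (hD : G.IsACComponent D) {x y : V}
    (hx : x ∈ D) (hy : y ∉ D) : ¬ G.Dir x y :=
  fun h => hy (hD.mem_of_dir hx h)

theorem IsInterval.arc_iff {G : Dgraph V} {D : Set V} (hD : G.IsInterval D) {x y z : V}
    (hx : x ∉ D) (hy : y ∈ D) (hz : z ∈ D) : G.Arc x y ↔ G.Arc x z := by
  rcases hD x hx with h | h | h | h <;> simp [h y hy, h z hz]

end Basic

section Twist

/-- Reverse every arc whose source satisfies `p`. For `p` constant on arc-connected components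
this dualizes the components on which `p` holds. -/
def twist (G : Dgraph V) (p : V → Prop) : Dgraph V :=
  ⟨fun x y => (p x ∧ G.Arc y x) ∨ (¬ p x ∧ G.Arc x y), fun x => by simp [G.irrefl]⟩

/-- `p` is constant on the arc-connected components of `G`. -/
def DirInvariant (G : Dgraph V) (p : V → Prop) : Prop := ∀ x y, G.Dir x y → (p x ↔ p y)

variable {G : Dgraph V} {p : V → Prop}

theorem twist_true (G : Dgraph V) : G.twist (fun _ => True) = G.dual := by
  simp [twist, dual]

theorem twist_arc_of_pos {x y : V} (hx : p x) : (G.twist p).Arc x y ↔ G.Arc y x := by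
  simp [twist, hx]

theorem twist_arc_of_neg {x y : V} (hx : ¬ p x) : (G.twist p).Arc x y ↔ G.Arc x y := by
  simp [twist, hx]

theorem twist_arc_of_not_dir {x y : V} (h : ¬ G.Dir x y) :
    (G.twist p).Arc x y ↔ G.Arc x y := by
  by_cases hx : p x
  · rw [twist_arc_of_pos hx, arc_comm_of_not_dir h]
  · exact twist_arc_of_neg hx

theorem DirInvariant.dir_twist (hp : G.DirInvariant p) (x y : V) :
    (G.twist p).Dir x y ↔ G.Dir x y := by
  by_cases h : G.Dir x y
  · have := hp x y h
    by_cases hx : p x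
    · have hy := this.1 hx
      simp only [Dir, twist_arc_of_pos hx, twist_arc_of_pos hy]
      exact or_comm
    · have hy := mt this.2 hx
      simp only [Dir, twist_arc_of_neg hx, twist_arc_of_neg hy]
  · have h' : ¬ G.Dir y x := fun h' => h h'.symm
    simp only [Dir, twist_arc_of_not_dir h, twist_arc_of_not_dir h']

theorem DirInvariant.twist (hp : G.DirInvariant p) : (G.twist p).DirInvariant p :=
  fun x y h => hp x y ((hp.dir_twist x y).1 h)

theorem DirInvariant.twist_twist (hp : G.DirInvariant p) : (G.twist p).twist p = G := by
  have : ((G.twist p).twist p).Arc = G.Arc := by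
    ext x y
    by_cases h : G.Dir x y
    · have := hp x y h
      by_cases hx : p x
      · rw [twist_arc_of_pos hx, twist_arc_of_pos (this.1 hx)]
      · rw [twist_arc_of_neg hx, twist_arc_of_neg hx]
    · rw [twist_arc_of_not_dir ((hp.dir_twist x y).not.2 h), twist_arc_of_not_dir h]
  cases G
  simpa [Dgraph.twist] using this

theorem IsACComponent.dirInvariant {D : Set V} (hD : G.IsACComponent D) :
    G.DirInvariant (· ∈ D) :=
  fun _ _ h => ⟨fun hx => hD.mem_of_dir hx h, fun hy => hD.mem_of_dir hy h.symm⟩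

theorem twist_ind_of_pos {Y : Set V} (hY : ∀ x ∈ Y, p x) : (G.twist p).ind Y = (G.ind Y).dual := by
  have : ∀ x y : Y, ((G.twist p).Arc x y) = G.Arc y x := fun x y =>
    propext (twist_arc_of_pos (hY x x.2))
  simp only [ind, dual, this]

theorem twist_ind_of_neg {Y : Set V} (hY : ∀ x ∈ Y, ¬ p x) : (G.twist p).ind Y = G.ind Y := by
  have : ∀ x y : Y, ((G.twist p).Arc x y) = G.Arc x y := fun x y =>
    propext (twist_arc_of_neg (hY x x.2))
  simp only [ind, this]

theorem DirInvariant.acRel_twist (hp : G.DirInvariant p) : (G.twist p).ACRel = G.ACRel := by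
  have : (G.twist p).Dir = G.Dir := by
    ext x y
    exact hp.dir_twist x y
  simp only [ACRel, this]

theorem DirInvariant.acRel_iff (hp : G.DirInvariant p) {x y : V} (h : G.ACRel x y) :
    p x ↔ p y := by
  induction h with
  | refl => rfl
  | tail _ h ih => exact ih.trans (hp _ _ h)

theorem DirInvariant.const_on (hp : G.DirInvariant p) {D : Set V} (hD : G.IsACComponent D) :
    (∀ x ∈ D, p x) ∨ ∀ x ∈ D, ¬ p x := by
  obtain ⟨c, rfl⟩ := hD
  by_cases hc : p c
  · exact .inl fun x hx => (hp.acRel_iff hx).1 hc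
  · exact .inr fun x hx => mt (hp.acRel_iff hx).2 hc

theorem DirInvariant.hemi_twist_ind (hp : G.DirInvariant p) {D : Set V}
    (hD : G.IsACComponent D) : Hemi (G.ind D) ((G.twist p).ind D) := by
  rcases hp.const_on hD with h | h
  · rw [twist_ind_of_pos h]
    exact .inr (Iso.refl _)
  · rw [twist_ind_of_neg h]
    exact .inl (Iso.refl _)

end Twist

section Reversible

/-- Every subdigraph on at most `n` vertices of `D` is self-dual. -/
def SelfDualUpTo (G : Dgraph V) (n : ℕ) (D : Set V) : Prop :=
  ∀ Y ⊆ D, Y.Finite → Y.ncard ≤ n → SelfDual (G.ind Y)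

/-- No directed pair outside `D` is distinguished by a vertex of `D`. -/
def NotSeparating (G : Dgraph V) (D : Set V) : Prop :=
  ∀ x ∉ D, ∀ y ∉ D, G.Dir x y → ∀ z ∈ D, G.Arc x z ↔ G.Arc y z

/-- Non-self-dual components that can be dualized without changing subdigraphs on at most
six vertices, up to hemimorphy. -/
structure Reversible (G : Dgraph V) (D : Set V) : Prop where
  comp : G.IsACComponent D
  interval : G.IsInterval D
  not_selfDual : ¬ SelfDual (G.ind D)
  three : G.SelfDualUpTo 3 D
  four : G.SelfDualUpTo 4 D ∨ G.NotSeparating D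

variable {G H : Dgraph V} {p : V → Prop} {D : Set V}

theorem SelfDualUpTo.twist (hp : G.DirInvariant p) (hD : G.IsACComponent D) {n : ℕ}
    (h : G.SelfDualUpTo n D) : (G.twist p).SelfDualUpTo n D := by
  intro Y hY hfin hn
  rcases hp.const_on hD with hc | hc
  · rw [twist_ind_of_pos fun x hx => hc x (hY hx)]
    exact (h Y hY hfin hn).dual
  · rw [twist_ind_of_neg fun x hx => hc x (hY hx)]
    exact h Y hY hfin hn

theorem Reversible.twist (hp : G.DirInvariant p) (h : G.Reversible D) :
    (G.twist p).Reversible D where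
  comp := by simpa only [IsACComponent, hp.acRel_twist] using h.comp
  interval x hx := by
    have h₁ : ∀ y ∈ D, (G.twist p).Arc x y ↔ G.Arc x y := fun y hy =>
      twist_arc_of_not_dir fun h' => h.comp.not_dir hy hx h'.symm
    have h₂ : ∀ y ∈ D, (G.twist p).Arc y x ↔ G.Arc y x := fun y hy =>
      twist_arc_of_not_dir (h.comp.not_dir hy hx)
    rcases h.interval x hx with h' | h' | h' | h'
    · exact .inl fun y hy => by simp [h₁ y hy, h₂ y hy, h' y hy]
    · exact .inr (.inl fun y hy => by simp [h₁ y hy, h₂ y hy, h' y hy])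
    · exact .inr (.inr (.inl fun y hy => by simp [h₁ y hy, h₂ y hy, h' y hy]))
    · exact .inr (.inr (.inr fun y hy => by simp [h₁ y hy, h₂ y hy, h' y hy]))
  not_selfDual hs := by
    refine h.not_selfDual ?_
    rcases hp.const_on h.comp with hc | hc
    · rw [twist_ind_of_pos hc] at hs
      exact hs.dual
    · rwa [twist_ind_of_neg hc] at hs
  three := h.three.twist hp h.comp
  four := by
    refine h.four.imp (fun h' => h'.twist hp h.comp) fun h' x hx y hy hxy z hz => ?_
    rw [twist_arc_of_not_dir fun h'' => h.comp.not_dir hz hx h''.symm,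
      twist_arc_of_not_dir fun h'' => h.comp.not_dir hz hy h''.symm]
    exact h' x hx y hy ((hp.dir_twist x y).1 hxy) z hz

theorem DirInvariant.reversible_twist_iff (hp : G.DirInvariant p) :
    (G.twist p).Reversible D ↔ G.Reversible D :=
  ⟨fun h => by simpa only [hp.twist_twist] using h.twist hp.twist, fun h => h.twist hp⟩

theorem Reversible.dual (h : G.Reversible D) : G.dual.Reversible D := by
  rw [← twist_true]
  exact h.twist fun _ _ _ => Iff.rfl

theorem SelfDualUpTo.image (e : V ≃ V) (he : ∀ x y, G.Arc x y ↔ H.Arc (e x) (e y)) {n : ℕ}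
    (h : G.SelfDualUpTo n D) : H.SelfDualUpTo n (e '' D) := by
  intro Y hY hfin hn
  obtain ⟨Z, hZ, rfl⟩ := Set.subset_image_iff.1 hY
  rw [Set.ncard_image_of_injective _ e.injective] at hn
  exact (h Z hZ (hfin.of_finite_image e.injective.injOn) hn).of_iso (iso_ind_image e he Z)

theorem Reversible.image (e : V ≃ V) (he : ∀ x y, G.Arc x y ↔ H.Arc (e x) (e y))
    (h : G.Reversible D) : H.Reversible (e '' D) where
  comp := by
    obtain ⟨c, rfl⟩ := h.comp
    refine ⟨e c, ?_⟩
    have hd : ∀ x y, G.Dir x y ↔ H.Dir (e x) (e y) := fun x y => by simp only [Dir, he]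
    ext y
    constructor
    · rintro ⟨x, hx, rfl⟩
      exact Relation.ReflTransGen.lift e (fun a b => (hd a b).1) _ _ hx
    · intro hy
      refine ⟨e.symm y, ?_, e.apply_symm_apply y⟩
      have := Relation.ReflTransGen.lift (r := H.Dir) (p := G.Dir) e.symm
        (fun a b hab => (hd _ _).2 (by simpa using hab)) _ _ hy
      simp only [Function.onFun, e.symm_apply_apply] at this
      exact this
  interval x hx := by
    have hx' : e.symm x ∉ D := fun h' => hx ⟨_, h', e.apply_symm_apply x⟩
    simpa only [he, e.apply_symm_apply, Set.forall_mem_image] using h.interval _ hx'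
  not_selfDual hs := h.not_selfDual (hs.of_iso (iso_ind_image e he D).symm)
  three := h.three.image e he
  four := by
    refine h.four.imp (fun h' => h'.image e he) fun h' x hx y hy hxy z hz => ?_
    obtain ⟨x, rfl⟩ := e.surjective x
    obtain ⟨y, rfl⟩ := e.surjective y
    obtain ⟨z, hz, rfl⟩ := hz
    rw [← he, ← he]
    refine h' x (fun h => hx ⟨x, h, rfl⟩) y (fun h => hy ⟨y, h, rfl⟩) ?_ z hz
    simpa only [Dir, he] using hxy

end Reversible

section Hemimorphy

variable {G : Dgraph V} {p : V → Prop}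

/-- If every dualized component meets `X` in a self-dual subdigraph, gluing the
anti-automorphisms shows that dualizing does not change `G[X]`. -/
theorem iso_ind_twist (hp : G.DirInvariant p)
    (hrev : ∀ x, p x → G.IsInterval {y | G.ACRel x y}) {X : Set V}
    (hX : ∀ x ∈ X, p x → SelfDual (G.ind (X ∩ {y | G.ACRel x y}))) :
    Iso (G.ind X) ((G.twist p).ind X) := by
  classical
  have hσ : ∀ C : Set V, ∃ σ : Equiv.Perm V, SelfDual (G.ind (X ∩ C)) →
      (∀ x, x ∈ X ∩ C ↔ σ x ∈ X ∩ C) ∧ (∀ x ∉ X ∩ C, σ x = x) ∧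
      ∀ x ∈ X ∩ C, ∀ y ∈ X ∩ C, G.Arc x y ↔ G.Arc (σ y) (σ x) := by
    intro C
    by_cases h : SelfDual (G.ind (X ∩ C))
    · obtain ⟨σ, h'⟩ := h.exists_perm
      exact ⟨σ, fun _ => h'⟩
    · exact ⟨1, fun h' => absurd h' h⟩
  choose σ hσ using hσ
  let C : V → Set V := fun x => {y | G.ACRel x y}
  have hC : ∀ {x y}, y ∈ C x → C y = C x := fun {x y} h =>
    (IsACComponent.eq_of_mem ⟨x, rfl⟩ h).symm
  have hself : ∀ x, x ∈ C x := fun x => .refl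
  let f : V → V := fun x => if x ∈ X ∧ p x then σ (C x) x else x
  let g : V → V := fun x => if x ∈ X ∧ p x then (σ (C x)).symm x else x
  have hmem : ∀ x ∈ X, p x → σ (C x) x ∈ X ∩ C x := fun x hx hpx =>
    ((hσ (C x) (hX x hx hpx)).1 x).1 ⟨hx, hself x⟩
  have hmem' : ∀ x ∈ X, p x → (σ (C x)).symm x ∈ X ∩ C x := fun x hx hpx =>
    ((hσ (C x) (hX x hx hpx)).1 _).2 (by simpa using ⟨hx, hself x⟩)
  have hpC : ∀ {x y}, y ∈ C x → p x → p y := fun h hx => (hp.acRel_iff h).1 hx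
  have hgf : ∀ x, g (f x) = x := by
    intro x
    by_cases h : x ∈ X ∧ p x
    · have hm := hmem x h.1 h.2
      have : f x = σ (C x) x := if_pos h
      rw [this]
      have : g (σ (C x) x) = _ := if_pos ⟨hm.1, hpC hm.2 h.2⟩
      rw [this, hC hm.2, Equiv.symm_apply_apply]
    · have : f x = x := if_neg h
      rw [this]
      exact if_neg h
  have hfg : ∀ x, f (g x) = x := by
    intro x
    by_cases h : x ∈ X ∧ p x
    · have hm := hmem' x h.1 h.2
      have : g x = (σ (C x)).symm x := if_pos h
      rw [this]
      have : f ((σ (C x)).symm x) = _ := if_pos ⟨hm.1, hpC hm.2 h.2⟩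
      rw [this, hC hm.2, Equiv.apply_symm_apply]
    · have : g x = x := if_neg h
      rw [this]
      exact if_neg h
  have hfX : ∀ x ∈ X, f x ∈ X := by
    intro x hx
    by_cases h : p x
    · rw [show f x = σ (C x) x from if_pos ⟨hx, h⟩]
      exact (hmem x hx h).1
    · rwa [show f x = x from if_neg fun h' => h h'.2]
  have hgX : ∀ x ∈ X, g x ∈ X := by
    intro x hx
    by_cases h : p x
    · rw [show g x = (σ (C x)).symm x from if_pos ⟨hx, h⟩]
      exact (hmem' x hx h).1
    · rwa [show g x = x from if_neg fun h' => h h'.2]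
  have hfC : ∀ x, f x ∈ C x := by
    intro x
    by_cases h : x ∈ X ∧ p x
    · rw [show f x = σ (C x) x from if_pos h]
      exact (hmem x h.1 h.2).2
    · rw [show f x = x from if_neg h]
      exact hself x
  refine iso_ind_of_perm ⟨f, g, hgf, hfg⟩ (fun x => ⟨hfX x, fun h => ?_⟩) fun x hx y hy => ?_
  · have := hgX _ h
    rwa [show g ((⟨f, g, hgf, hfg⟩ : Equiv.Perm V) x) = x from hgf x] at this
  change G.Arc x y ↔ (G.twist p).Arc (f x) (f y)
  by_cases hxy : y ∈ C x
  · by_cases hpx : p x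
    · have hpy := hpC hxy hpx
      rw [twist_arc_of_pos (hpC (hfC x) hpx)]
      rw [show f x = σ (C x) x from if_pos ⟨hx, hpx⟩,
        show f y = σ (C y) y from if_pos ⟨hy, hpy⟩, hC hxy]
      exact (hσ (C x) (hX x hx hpx)).2.2 x ⟨hx, hself x⟩ y ⟨hy, hxy⟩
    · have hpy : ¬ p y := fun h => hpx ((hp.acRel_iff hxy).2 h)
      rw [show f x = x from if_neg fun h => hpx h.2,
        show f y = y from if_neg fun h => hpy h.2, twist_arc_of_neg hpx]
  · have hsep : ∀ u ∈ C x, ∀ v ∈ C y, v ∉ C x := by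
      intro u _ v hv hv'
      apply hxy
      rw [← hC hv', hC hv]
      exact hself y
    have hnd : ∀ u ∈ C x, ∀ v ∈ C y, ¬ G.Dir u v := fun u hu v hv =>
      IsACComponent.not_dir ⟨x, rfl⟩ hu (hsep u hu v hv)
    rw [twist_arc_of_not_dir (hnd _ (hfC x) _ (hfC y))]
    have h₁ : G.Arc x y ↔ G.Arc (f x) y := by
      by_cases hpx : p x
      · rw [arc_comm_of_not_dir (hnd x (hself x) y (hself y)),
          arc_comm_of_not_dir (hnd _ (hfC x) y (hself y))]
        exact (hrev x hpx).arc_iff hxy (hself x) (hfC x)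
      · rw [show f x = x from if_neg fun h => hpx h.2]
    have h₂ : G.Arc (f x) y ↔ G.Arc (f x) (f y) := by
      by_cases hpy : p y
      · refine (hrev y hpy).arc_iff (fun h => ?_) (hself y) (hfC y)
        exact hsep _ (hfC x) _ h (hfC x)
      · rw [show f y = y from if_neg fun h => hpy h.2]
    exact h₁.trans h₂

/-- If a dualized component meets `X` in a non-self-dual subdigraph, then at most one directed
pair remains outside of it, and dualizing turns `G[X]` into its dual. -/
theorem iso_dual_ind_twist (hp : G.DirInvariant p) {D X : Set V} (hD : G.Reversible D)
    (hpD : ∀ x ∈ D, p x) (hfin : X.Finite) (hcard : X.ncard ≤ 6)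
    (hX : ¬ SelfDual (G.ind (X ∩ D))) : Iso (G.dual.ind X) ((G.twist p).ind X) := by
  classical
  by_cases h : ∃ x ∈ X, ∃ y ∈ X, G.Dir x y ∧ ¬ p x
  · obtain ⟨x, hx, y, hy, hxy, hpx⟩ := h
    have hpy : ¬ p y := fun h => hpx ((hp x y hxy).2 h)
    have hxD : x ∉ D := fun h => hpx (hpD x h)
    have hyD : y ∉ D := fun h => hpy (hpD y h)
    have hne : x ≠ y := by
      rintro rfl
      simp [Dir] at hxy
    have hfinD : (X ∩ D).Finite := hfin.subset Set.inter_subset_left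
    have h3 : 3 < (X ∩ D).ncard := by
      by_contra h
      exact hX (hD.three _ Set.inter_subset_right hfinD (not_lt.1 h))
    have hsub : {x, y} ⊆ X \ D := by
      rintro z (rfl | rfl)
      exacts [⟨hx, hxD⟩, ⟨hy, hyD⟩]
    have hfinX : (X \ D).Finite := hfin.subset Set.sdiff_subset
    have hle := Set.ncard_le_ncard hsub hfinX
    have hsum := Set.ncard_inter_add_ncard_sdiff_eq_ncard X D hfin
    rw [Set.ncard_pair hne] at hle
    have hsep : G.NotSeparating D := by
      refine hD.four.resolve_left fun h4 => hX (h4 _ Set.inter_subset_right hfinD (by omega))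
    have hout : ∀ z ∈ X, z ∈ D ∨ z = x ∨ z = y := by
      intro z hz
      by_cases hzD : z ∈ D
      · exact .inl hzD
      · have : {x, y} = X \ D :=
          Set.eq_of_subset_of_ncard_le hsub (by rw [Set.ncard_pair hne]; omega) hfinX
        have hz' : z ∈ ({x, y} : Set V) := this ▸ ⟨hz, hzD⟩
        exact .inr hz'
    have hfix : ∀ z ∈ D, Equiv.swap x y z = z := fun z hz =>
      Equiv.swap_apply_of_ne_of_ne (fun h => hxD (h ▸ hz)) fun h => hyD (h ▸ hz)
    have harc : ∀ z ∈ D, G.Arc x z ↔ G.Arc y z := hsep x hxD y hyD hxy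
    have hcx : ∀ z ∈ D, G.Arc z x ↔ G.Arc x z := fun z hz =>
      arc_comm_of_not_dir (hD.comp.not_dir hz hxD)
    have hcy : ∀ z ∈ D, G.Arc z y ↔ G.Arc y z := fun z hz =>
      arc_comm_of_not_dir (hD.comp.not_dir hz hyD)
    refine iso_ind_of_perm (Equiv.swap x y) (fun z => ?_) fun u hu v hv => ?_
    · by_cases hzx : z = x
      · simp [hzx, hx, hy]
      by_cases hzy : z = y
      · simp [hzy, hx, hy]
      rw [Equiv.swap_apply_of_ne_of_ne hzx hzy]
    · change G.Arc v u ↔ _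
      rcases hout u hu with huD | rfl | rfl <;> rcases hout v hv with hvD | rfl | rfl
      · rw [hfix u huD, hfix v hvD, twist_arc_of_pos (hpD u huD)]
      · rw [hfix u huD, Equiv.swap_apply_left, twist_arc_of_pos (hpD u huD), harc u huD]
      · rw [hfix u huD, Equiv.swap_apply_right, twist_arc_of_pos (hpD u huD), harc u huD]
      · rw [hfix v hvD, Equiv.swap_apply_left, twist_arc_of_neg hpy, hcx v hvD, harc v hvD]
      · simp [G.irrefl, (G.twist p).irrefl]
      · rw [Equiv.swap_apply_left, Equiv.swap_apply_right, twist_arc_of_neg hpy]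
      · rw [hfix v hvD, Equiv.swap_apply_right, twist_arc_of_neg hpx, hcy v hvD, harc v hvD]
      · rw [Equiv.swap_apply_left, Equiv.swap_apply_right, twist_arc_of_neg hpx]
      · simp [G.irrefl, (G.twist p).irrefl]
  · push Not at h
    refine iso_ind_of_perm 1 (fun _ => Iff.rfl) fun u hu v hv => ?_
    change G.Arc v u ↔ (G.twist p).Arc u v
    by_cases hpu : p u
    · rw [twist_arc_of_pos hpu]
    · rw [twist_arc_of_neg hpu]
      exact (arc_comm_of_not_dir fun h' => hpu (h u hu v hv h')).symm

theorem leHemi_twist (hp : G.DirInvariant p) (hrev : ∀ x, p x → G.Reversible {y | G.ACRel x y}) :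
    LeHemi 6 G (G.twist p) := by
  intro j _ hj X hfin hcard
  by_cases h : ∀ x ∈ X, p x → SelfDual (G.ind (X ∩ {y | G.ACRel x y}))
  · exact .inl (iso_ind_twist hp (fun x hx => (hrev x hx).interval) h)
  · push Not at h
    obtain ⟨x, -, hpx, hns⟩ := h
    exact .inr (iso_dual_ind_twist hp (hrev x hpx) (fun y hy => (hp.acRel_iff hy).1 hpx) hfin
      (hcard.trans_le hj) hns)

theorem Reversible.leHemi_twist {D : Set V} (h : G.Reversible D) :
    LeHemi 6 G (G.twist (· ∈ D)) :=
  Dgraph.leHemi_twist h.comp.dirInvariant fun x hx => by rwa [← h.comp.eq_of_mem hx]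

end Hemimorphy

section NonHemimorphy

variable {G H : Dgraph V}

/-- The reversible components hemimorphic to `T` are pairwise isomorphic. -/
def UniformOn (G : Dgraph V) (T : Dgraph U) : Prop :=
  ∀ D E, G.Reversible D → G.Reversible E → Hemi T (G.ind D) → Hemi T (G.ind E) →
    Iso (G.ind D) (G.ind E)

theorem UniformOn.of_iso {T : Dgraph U} (hG : G.UniformOn T) (h : Iso H G) : H.UniformOn T := by
  obtain ⟨e, he⟩ := h
  intro D E hD hE hTD hTE
  have h₁ := iso_ind_image e he D
  have h₂ := iso_ind_image e he E
  exact (h₁.trans (hG _ _ (hD.image e he) (hE.image e he) (hTD.trans (.inl h₁))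
    (hTE.trans (.inl h₂)))).trans h₂.symm

theorem UniformOn.dual {T : Dgraph U} (hG : G.UniformOn T) : G.dual.UniformOn T :=
  fun D E hD hE hTD hTE => (hG D E hD.dual hE.dual
    (hTD.trans (.inr (Iso.refl _))) (hTE.trans (.inr (Iso.refl _)))).dual

theorem UniformOn.of_hemi {T : Dgraph U} (hG : G.UniformOn T) (h : Hemi H G) : H.UniformOn T := by
  rcases h with h | h
  · exact hG.of_iso h
  · exact UniformOn.dual (G := H.dual) (hG.of_iso h)

theorem not_halfRecon_of_hemi {D E : Set V} (hD : G.Reversible D) (hE : G.Reversible E)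
    (hne : D ≠ E) (hDE : Hemi (G.ind D) (G.ind E)) : ¬ G.HalfRecon 6 := by
  intro hrec
  by_cases hu : G.UniformOn (G.ind D)
  · have hp := hD.comp.dirInvariant
    have hu' := hu.of_hemi (hrec _ hD.leHemi_twist).symm
    have hED : ∀ x ∈ E, x ∉ D := fun x hxE hxD =>
      hne (hD.comp.eq_of_mem_of_mem hE.comp hxD hxE)
    have h := hu' D E (hD.twist hp) (hE.twist hp) (hp.hemi_twist_ind hD.comp)
      (hDE.trans (hp.hemi_twist_ind hE.comp))
    rw [twist_ind_of_pos fun _ h => h, twist_ind_of_neg hED] at h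
    exact hD.not_selfDual ((hu D E hD hE (.inl (Iso.refl _)) hDE).trans h.symm)
  · let q : Set V → Prop := fun C =>
      G.Reversible C ∧ Hemi (G.ind D) (G.ind C) ∧ ¬ Iso (G.ind D) (G.ind C)
    let p : V → Prop := fun x => q {y | G.ACRel x y}
    have hpq : ∀ C, G.IsACComponent C → ∀ x ∈ C, (p x ↔ q C) := fun C hC x hx => by
      rw [hC.eq_of_mem hx]
    have hp : G.DirInvariant p := fun x y h =>
      (hpq {z | G.ACRel x z} ⟨x, rfl⟩ y (.single h)).symm
    have hrev : ∀ x, p x → G.Reversible {y | G.ACRel x y} := fun x hx => hx.1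
    refine hu (UniformOn.of_hemi ?_ (hrec _ (leHemi_twist hp hrev)))
    suffices h : ∀ C, (G.twist p).Reversible C → Hemi (G.ind D) ((G.twist p).ind C) →
        Iso (G.ind D) ((G.twist p).ind C) from
      fun A B hA hB hTA hTB => (h A hA hTA).symm.trans (h B hB hTB)
    intro C hC hDC
    rw [hp.reversible_twist_iff] at hC
    have hDC' := hDC.trans (hp.hemi_twist_ind hC.comp).symm
    by_cases hq : q C
    · rw [twist_ind_of_pos fun x hx => (hpq C hC.comp x hx).2 hq]
      exact (hDC'.resolve_left hq.2.2).dual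
    · rw [twist_ind_of_neg fun x hx => mt (hpq C hC.comp x hx).1 hq]
      by_contra hn
      exact hq ⟨hC, hDC', hn⟩

theorem not_iso_twist_of_unique {D : Set V} (hD : G.Reversible D)
    (huniq : ∀ E, G.Reversible E → Hemi (G.ind D) (G.ind E) → E = D) :
    ¬ Iso G (G.twist (· ∈ D)) := by
  rintro ⟨e, he⟩
  have hp := hD.comp.dirInvariant
  have hi := iso_ind_image e he D
  have hr := hp.reversible_twist_iff.1 (hD.image e he)
  have := huniq _ hr ((Hemi.trans (.inl hi) (hp.hemi_twist_ind hr.comp).symm))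
  rw [this, twist_ind_of_pos fun _ h => h] at hi
  exact hD.not_selfDual hi

theorem exists_perm_of_dual_iso_twist {D E : Set V} (hD : G.Reversible D) (hE : G.Reversible E)
    (huniq : ∀ F, G.Reversible F → Hemi (G.ind E) (G.ind F) → F = E)
    (h : Iso G.dual (G.twist (· ∈ D))) :
    ∃ e : Equiv.Perm V, e '' E = E ∧ ∀ x y, G.Arc y x ↔ (G.twist (· ∈ D)).Arc (e x) (e y) := by
  obtain ⟨e, he⟩ := h
  have hp := hD.comp.dirInvariant
  have hi := iso_ind_image e he E
  have hr := hp.reversible_twist_iff.1 (hE.dual.image e he)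
  exact ⟨e, huniq _ hr (Hemi.trans (.inr hi) (hp.hemi_twist_ind hr.comp).symm), he⟩

theorem not_halfRecon_of_two {D E : Set V} (hD : G.Reversible D) (hE : G.Reversible E)
    (hne : D ≠ E) : ¬ G.HalfRecon 6 := by
  by_cases h₁ : ∃ F, G.Reversible F ∧ Hemi (G.ind D) (G.ind F) ∧ D ≠ F
  · obtain ⟨F, hF, hDF, hne⟩ := h₁
    exact not_halfRecon_of_hemi hD hF hne hDF
  by_cases h₂ : ∃ F, G.Reversible F ∧ Hemi (G.ind E) (G.ind F) ∧ E ≠ F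
  · obtain ⟨F, hF, hEF, hne⟩ := h₂
    exact not_halfRecon_of_hemi hE hF hne hEF
  push Not at h₁ h₂
  intro hrec
  rcases hrec _ hD.leHemi_twist with h | h
  · exact not_iso_twist_of_unique hD (fun F hF h => (h₁ F hF h).symm) h
  · obtain ⟨e, heE, he⟩ := exists_perm_of_dual_iso_twist hD hE
      (fun F hF h => (h₂ F hF h).symm) h
    have hED : ∀ x ∈ E, x ∉ D := fun x hxE hxD =>
      hne (hD.comp.eq_of_mem_of_mem hE.comp hxD hxE)
    have hi := iso_ind_image (G := G.dual) e he E
    rw [heE, twist_ind_of_neg hED] at hi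
    exact hE.not_selfDual hi.symm

theorem not_halfRecon_of_unique {D : Set V} (hD : G.Reversible D)
    (huniq : ∀ E, G.Reversible E → E = D) (hc : ¬ ContractIsoFix G G.dual D) :
    ¬ G.HalfRecon 6 := by
  intro hrec
  rcases hrec _ hD.leHemi_twist with h | h
  · exact not_iso_twist_of_unique hD (fun F hF _ => huniq F hF) h
  obtain ⟨e, heD, he⟩ := exists_perm_of_dual_iso_twist hD hD (fun F hF _ => huniq F hF) h
  have hmem : ∀ x, e x ∈ D ↔ x ∈ D := fun x => by
    conv_lhs => rw [← heD]
    simp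
  have hout : ∀ x ∉ D, ∀ y, G.Arc y x ↔ G.Arc (e x) (e y) := fun x hx y => by
    rw [he, twist_arc_of_neg (mt (hmem x).1 hx)]
  have hnd : ∀ x ∉ D, ∀ y ∈ D, (G.Arc x y ↔ G.Arc y x) := fun x hx y hy =>
    (arc_comm_of_not_dir (hD.comp.not_dir hy hx)).symm
  have hex : ∀ x ∉ D, (∃ z ∈ D, G.Arc x z) ↔ ∃ z ∈ D, G.Arc z (e x) := by
    intro x hx
    conv_rhs => rw [← heD]
    rw [Set.exists_mem_image]
    refine exists_congr fun z => and_congr_right fun hz => ?_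
    rw [hnd x hx z hz, hout x hx, hnd _ (mt (hmem x).1 hx) _ ((hmem z).2 hz)]
  have hex' : ∀ x ∉ D, (∃ z ∈ D, G.Arc x z) ↔ ∃ z ∈ D, G.Arc z x := fun x hx =>
    exists_congr fun z => and_congr_right fun hz => hnd x hx z hz
  refine hc ⟨Equiv.optionCongr (e.subtypeEquiv fun x => (hmem x).not.symm), rfl, ?_⟩
  rintro (_ | ⟨x, hx⟩) (_ | ⟨y, hy⟩)
  · simp [contract]
  · change (∃ z ∈ D, G.Arc z y) ↔ ∃ z ∈ D, G.Arc (e y) z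
    rw [← hex' y hy, hex y hy, hex' _ (mt (hmem y).1 hy)]
  · exact hex x hx
  · exact hout y hy x

end NonHemimorphy

section SelfDualSubdigraphs

variable {G : Dgraph V}

theorem selfDualUpTo_of_ind {D : Set V} {n : ℕ}
    (h : ∀ Y : Set D, Y.Finite → Y.ncard ≤ n → SelfDual ((G.ind D).ind Y)) :
    G.SelfDualUpTo n D := by
  intro Y hY hfin hn
  obtain ⟨Z, rfl⟩ : ∃ Z : Set D, Subtype.val '' Z = Y :=
    ⟨Subtype.val ⁻¹' Y, by simpa using hY⟩
  rw [Set.ncard_image_of_injective _ Subtype.val_injective] at hn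
  exact (h Z (hfin.of_finite_image Subtype.val_injective.injOn) hn).of_iso (iso_ind_ind G D Z)

theorem selfDual_of_ncard_lt_cdual {Y : Set V} (hfin : Y.Finite)
    (h : (Y.ncard : ℕ∞) < G.Cdual) : SelfDual (G.ind Y) := by
  by_contra hns
  exact absurd (sInf_le ⟨Y, hfin, hns, rfl⟩ : G.Cdual ≤ Y.ncard) (not_le.2 h)

theorem injective_vec_three {a b c : V} (hab : a ≠ b) (hac : a ≠ c) (hbc : b ≠ c) :
    Function.Injective ![a, b, c] := by
  intro i j
  fin_cases i <;> fin_cases j <;> simp [hab, hac, hbc, hab.symm, hac.symm, hbc.symm]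

theorem injective_vec_four {a b c d : V} (hab : a ≠ b) (hac : a ≠ c) (had : a ≠ d) (hbc : b ≠ c)
    (hbd : b ≠ d) (hcd : c ≠ d) : Function.Injective ![a, b, c, d] := by
  intro i j
  fin_cases i <;> fin_cases j <;>
    simp [hab, hac, had, hbc, hbd, hcd, hab.symm, hac.symm, had.symm, hbc.symm, hbd.symm, hcd.symm]

theorem iso_flagD {a b c : V} (hbc : G.Arc b c) (hcb : ¬ G.Arc c b) (hac : G.Arc a c)
    (hca : G.Arc c a) (hab : ¬ G.Arc a b) (hba : ¬ G.Arc b a) :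
    Iso (G.ind (Set.range ![b, c, a])) flagD := by
  have h₁ : b ≠ c := fun h => G.irrefl c (h ▸ hbc)
  have h₂ : b ≠ a := fun h => hcb (h ▸ hca)
  have h₃ : c ≠ a := fun h => G.irrefl a (h ▸ hac)
  refine iso_ind_range (injective_vec_three h₁ h₂ h₃) fun i j => ?_
  fin_cases i <;> fin_cases j <;> simp [flagD, ofRel, *, G.irrefl]

theorem not_isFlag_of_flagDisjoint {D : Set V} (hD : G.FlagDisjoint D) {a b c : V} (ha : a ∈ D) :
    ¬ Hemi (G.ind (Set.range ![b, c, a])) flagD := fun h =>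
  Set.notMem_empty a (hD _ h ▸ ⟨ha, 2, rfl⟩)

theorem notSeparating_of_flagDisjoint {D : Set V} (hc : G.IsACComponent D)
    (hD : G.FlagDisjoint D) : G.NotSeparating D := by
  have key : ∀ x ∉ D, ∀ y ∉ D, G.Dir x y → ∀ z ∈ D, G.Arc x z → G.Arc y z := by
    intro x hx y hy hxy z hz hxz
    by_contra hyz
    have hzx : G.Arc z x := (arc_comm_of_not_dir (hc.not_dir hz hx)).2 hxz
    have hzy : ¬ G.Arc z y := mt (arc_comm_of_not_dir (hc.not_dir hz hy)).1 hyz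
    rcases hxy with h | h
    · exact not_isFlag_of_flagDisjoint hD hz
        (.inr (iso_flagD (G := G.dual) h.1 h.2 hxz hzx hyz hzy))
    · exact not_isFlag_of_flagDisjoint hD hz (.inl (iso_flagD h.1 h.2 hzx hxz hzy hyz))
  exact fun x hx y hy hxy z hz => ⟨key x hx y hy hxy z hz, key y hy x hx hxy.symm z hz⟩

/-- The pair `{x, y}` is directed from `x` to `y`. -/
def To (G : Dgraph V) (x y : V) : Prop := G.Arc x y ∧ ¬ G.Arc y x

theorem IsPrechain.dual (h : G.IsPrechain) : G.dual.IsPrechain := by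
  refine ⟨fun X hX => h.1 X (hX.imp Or.symm Or.symm), fun X hX => h.2.1 X (Or.symm hX), ?_⟩
  rintro ⟨x, y, z, hyz, hxy, hxz⟩
  exact h.2.2 ⟨x, y, z, hyz, ⟨hxy.1, mt Or.symm hxy.2⟩, ⟨hxz.1, mt Or.symm hxz.2⟩⟩

theorem IsPrechain.not_to_to (h : G.IsPrechain) {x y z : V} (hyz : G.Neutral y z)
    (hxy : G.To x y) (hxz : G.To x z) : False := by
  have h₁ : x ≠ y := fun h => G.irrefl y (h ▸ hxy.1)
  have h₂ : x ≠ z := fun h => G.irrefl z (h ▸ hxz.1)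
  have hc := arc_comm_of_not_dir hyz.2
  have hinj := injective_vec_three h₁ h₂ hyz.1
  obtain ⟨hxy, hyx⟩ := hxy
  obtain ⟨hxz, hzx⟩ := hxz
  by_cases hy : G.Arc y z
  · have hz := hc.1 hy
    refine h.1 (Set.range ![x, y, z]) (.inl (.inl (iso_ind_range hinj fun i j => ?_)))
    fin_cases i <;> fin_cases j <;> simp [peakD1, ofRel, *, G.irrefl]
  · have hz := mt hc.2 hy
    refine h.1 (Set.range ![x, y, z]) (.inr (.inl (iso_ind_range hinj fun i j => ?_)))
    fin_cases i <;> fin_cases j <;> simp [peakD2, ofRel, *, G.irrefl]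

theorem IsPrechain.to_of_neutral (h : G.IsPrechain) {x y z : V} (hyz : G.Neutral y z)
    (hxy : x ≠ y) (hxz : x ≠ z) : (G.To y x ∧ G.To x z) ∨ (G.To z x ∧ G.To x y) := by
  have hdy : G.Dir x y := by
    by_contra hd
    exact h.2.2 ⟨y, x, z, hxz, ⟨hxy.symm, mt Dir.symm hd⟩, hyz⟩
  have hdz : G.Dir x z := by
    by_contra hd
    exact h.2.2 ⟨z, x, y, hxy, ⟨hxz.symm, mt Dir.symm hd⟩, ⟨hyz.1.symm, mt Dir.symm hyz.2⟩⟩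
  have hyz' : G.dual.Neutral y z := ⟨hyz.1, mt Or.symm hyz.2⟩
  rcases hdy with h₁ | h₁ <;> rcases hdz with h₂ | h₂
  · exact (h.not_to_to hyz h₁ h₂).elim
  · exact .inr ⟨h₂, h₁⟩
  · exact .inl ⟨h₁, h₂⟩
  · exact (h.dual.not_to_to hyz' h₁ h₂).elim

theorem IsPrechain.not_diamond (h : G.IsPrechain) {a b c d : V} (hab : G.To a b) (hac : G.To a c)
    (had : G.To a d) (hbc : G.To b c) (hcd : G.To c d) (hdb : G.To d b) : False := by
  have hne : ∀ {x y}, G.To x y → x ≠ y := fun {x y} h h' => G.irrefl y (h' ▸ h.1)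
  have hinj := injective_vec_four (hne hab) (hne hac) (hne had) (hne hbc) (hne hdb).symm (hne hcd)
  refine h.2.1 (Set.range ![a, b, c, d]) (.inl (iso_ind_range hinj fun i j => ?_))
  unfold To at *
  fin_cases i <;> fin_cases j <;> simp [diamondD, ofRel, *, G.irrefl]

theorem range_vec_four (a b c d : V) : Set.range ![a, b, c, d] = {a, b, c, d} := by
  ext x
  simp [eq_comm]
  tauto

theorem selfDual_three {a b c : V} (hab : a ≠ b) (hac : a ≠ c) (hbc : b ≠ c)
    (h₁ : G.Arc a c ↔ G.Arc c b) (h₂ : G.Arc c a ↔ G.Arc b c) :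
    SelfDual (G.ind {a, b, c}) := by
  have hr : Set.range ![a, b, c] = {a, b, c} := by
    ext x
    simp [eq_comm]
    tauto
  rw [← hr]
  refine selfDual_ind_range (injective_vec_three hab hac hbc) (Equiv.swap 0 1) fun i j => ?_
  fin_cases i <;> fin_cases j <;> simp [Equiv.swap_apply_def, *, G.irrefl]

theorem selfDual_four_of_swap {a b c d : V} (hab : a ≠ b) (hac : a ≠ c) (had : a ≠ d)
    (hbc : b ≠ c) (hbd : b ≠ d) (hcd : c ≠ d)
    (h₁ : G.Arc a c ↔ G.Arc c b) (h₂ : G.Arc c a ↔ G.Arc b c)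
    (h₃ : G.Arc a d ↔ G.Arc d b) (h₄ : G.Arc d a ↔ G.Arc b d)
    (h₅ : G.Arc c d ↔ G.Arc d c) : SelfDual (G.ind {a, b, c, d}) := by
  rw [← range_vec_four]
  refine selfDual_ind_range (injective_vec_four hab hac had hbc hbd hcd) (Equiv.swap 0 1)
    fun i j => ?_
  fin_cases i <;> fin_cases j <;> simp [Equiv.swap_apply_def, *, G.irrefl]

theorem selfDual_four_of_swap_swap {a b c d : V} (hab : a ≠ b) (hac : a ≠ c) (had : a ≠ d)
    (hbc : b ≠ c) (hbd : b ≠ d) (hcd : c ≠ d)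
    (h₁ : G.Arc a c ↔ G.Arc d b) (h₂ : G.Arc c a ↔ G.Arc b d)
    (h₃ : G.Arc a d ↔ G.Arc c b) (h₄ : G.Arc d a ↔ G.Arc b c) :
    SelfDual (G.ind {a, b, c, d}) := by
  rw [← range_vec_four]
  refine selfDual_ind_range (injective_vec_four hab hac had hbc hbd hcd)
    (Equiv.swap 0 1 * Equiv.swap 2 3) fun i j => ?_
  fin_cases i <;> fin_cases j <;> simp [Equiv.swap_apply_def, *, G.irrefl]

theorem selfDual_pair (a b : V) : SelfDual (G.ind {a, b}) := by
  classical
  refine iso_ind_of_perm (H := G.dual) (Equiv.swap a b) (fun x => ?_) ?_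
  · simp only [Set.mem_insert_iff, Set.mem_singleton_iff, Equiv.swap_apply_eq_iff,
      Equiv.swap_apply_left, Equiv.swap_apply_right]
    exact or_comm
  · rintro x (rfl | rfl) y (rfl | rfl) <;> simp [dual, G.irrefl]

theorem IsPrechain.selfDual_three_of_neutral (h : G.IsPrechain) {a b c : V}
    (hn : G.Neutral a b) (hac : a ≠ c) (hbc : b ≠ c) : SelfDual (G.ind {a, b, c}) := by
  have := h.to_of_neutral hn hac.symm hbc.symm
  unfold To at this
  exact selfDual_three hn.1 hac hbc (by tauto) (by tauto)

theorem IsPrechain.selfDual_three (h : G.IsPrechain) {a b c : V} (hab : a ≠ b) (hac : a ≠ c)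
    (hbc : b ≠ c) : SelfDual (G.ind {a, b, c}) := by
  have e₁ : ({a, b, c} : Set V) = {a, c, b} := by ext; simp; tauto
  have e₂ : ({a, b, c} : Set V) = {b, c, a} := by ext; simp; tauto
  by_cases d₁ : G.Dir a b
  swap
  · exact h.selfDual_three_of_neutral ⟨hab, d₁⟩ hac hbc
  by_cases d₂ : G.Dir a c
  swap
  · exact e₁ ▸ h.selfDual_three_of_neutral ⟨hac, d₂⟩ hab hbc.symm
  by_cases d₃ : G.Dir b c
  swap
  · exact e₂ ▸ h.selfDual_three_of_neutral ⟨hbc, d₃⟩ hab.symm hac.symm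
  have key : (G.Arc a c ↔ G.Arc c b) ∨ (G.Arc a b ↔ G.Arc b c) ∨ (G.Arc b a ↔ G.Arc a c) := by
    unfold Dir at d₁ d₂ d₃
    tauto
  rcases key with k | k | k
  · exact Dgraph.selfDual_three hab hac hbc k (by unfold Dir at d₂ d₃; tauto)
  · exact e₁ ▸ Dgraph.selfDual_three hac hab hbc.symm k (by unfold Dir at d₁ d₃; tauto)
  · exact e₂ ▸ Dgraph.selfDual_three hbc hab.symm hac.symm k (by unfold Dir at d₁ d₂; tauto)

theorem IsPrechain.selfDual_four_of_neutral (h : G.IsPrechain) {a b c d : V}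
    (hn : G.Neutral a b) (hac : a ≠ c) (had : a ≠ d) (hbc : b ≠ c) (hbd : b ≠ d)
    (hcd : c ≠ d) : SelfDual (G.ind {a, b, c, d}) := by
  have hc := h.to_of_neutral hn hac.symm hbc.symm
  have hd := h.to_of_neutral hn had.symm hbd.symm
  have hab := hn.1
  by_cases d₁ : G.Dir c d
  · by_cases hs : G.Arc a c ↔ G.Arc a d
    · unfold To at hc hd
      exact selfDual_four_of_swap_swap hab hac had hbc hbd hcd (by tauto) (by tauto)
        (by tauto) (by tauto)
    · have e : ({a, b, c, d} : Set V) = {c, d, a, b} := by ext; simp; tauto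
      rw [e]
      unfold To at hc hd
      have hc' := arc_comm_of_not_dir hn.2
      exact selfDual_four_of_swap hcd hac.symm hbc.symm had.symm hbd.symm hab (by tauto)
        (by tauto) (by tauto) (by tauto) hc'
  · unfold To at hc hd
    exact selfDual_four_of_swap hab hac had hbc hbd hcd (by tauto) (by tauto)
      (by tauto) (by tauto) (arc_comm_of_not_dir d₁)

theorem Dir.arc_iff {x y : V} (h : G.Dir x y) : G.Arc y x ↔ ¬ G.Arc x y := by
  unfold Dir at h
  tauto

theorem IsPrechain.not_diamond_of_dir (h : G.IsPrechain) {a b c d : V} (hab : G.Dir a b)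
    (hac : G.Dir a c) (had : G.Dir a d) (hbc : G.Dir b c) (hcd : G.Dir c d) (hdb : G.Dir d b) :
    ¬ ((G.Arc a b ↔ G.Arc a c) ∧ (G.Arc a c ↔ G.Arc a d) ∧ (G.Arc b c ↔ G.Arc c d) ∧
      (G.Arc c d ↔ G.Arc d b)) := by
  rintro ⟨h₁, h₂, h₃, h₄⟩
  have := hab.arc_iff
  have := hac.arc_iff
  have := had.arc_iff
  have := hbc.arc_iff
  have := hcd.arc_iff
  have := hdb.arc_iff
  have k₁ := h.not_diamond (a := a) (b := b) (c := c) (d := d)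
  have k₂ := h.not_diamond (a := a) (b := b) (c := d) (d := c)
  have k₃ := h.dual.not_diamond (a := a) (b := b) (c := c) (d := d)
  have k₄ := h.dual.not_diamond (a := a) (b := b) (c := d) (d := c)
  simp only [To, Dgraph.dual] at k₁ k₂ k₃ k₄
  grind

theorem IsPrechain.selfDual_four (h : G.IsPrechain) {a b c d : V} (hab : a ≠ b) (hac : a ≠ c)
    (had : a ≠ d) (hbc : b ≠ c) (hbd : b ≠ d) (hcd : c ≠ d) :
    SelfDual (G.ind {a, b, c, d}) := by
  have e₁ : ({a, b, c, d} : Set V) = {a, c, b, d} := by ext; simp; tauto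
  have e₂ : ({a, b, c, d} : Set V) = {a, d, b, c} := by ext; simp; tauto
  have e₃ : ({a, b, c, d} : Set V) = {b, c, a, d} := by ext; simp; tauto
  have e₄ : ({a, b, c, d} : Set V) = {b, d, a, c} := by ext; simp; tauto
  have e₅ : ({a, b, c, d} : Set V) = {c, d, a, b} := by ext; simp; tauto
  by_cases d₁ : G.Dir a b
  swap
  · exact h.selfDual_four_of_neutral ⟨hab, d₁⟩ hac had hbc hbd hcd
  by_cases d₂ : G.Dir a c
  swap
  · exact e₁ ▸ h.selfDual_four_of_neutral ⟨hac, d₂⟩ hab had hbc.symm hcd hbd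
  by_cases d₃ : G.Dir a d
  swap
  · exact e₂ ▸ h.selfDual_four_of_neutral ⟨had, d₃⟩ hab hac hbd.symm hcd.symm hbc
  by_cases d₄ : G.Dir b c
  swap
  · exact e₃ ▸ h.selfDual_four_of_neutral ⟨hbc, d₄⟩ hab.symm hbd hac.symm hcd had
  by_cases d₅ : G.Dir b d
  swap
  · exact e₄ ▸ h.selfDual_four_of_neutral ⟨hbd, d₅⟩ hab.symm hbc had.symm hcd.symm hac
  by_cases d₆ : G.Dir c d
  swap
  · exact e₅ ▸ h.selfDual_four_of_neutral ⟨hcd, d₆⟩ hac.symm hbc.symm had.symm hbd.symm hab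
  have hA := h.not_diamond_of_dir d₁ d₂ d₃ d₄ d₆ d₅.symm
  have hB := h.not_diamond_of_dir d₁.symm d₄ d₅ d₂ d₆ d₃.symm
  have hC := h.not_diamond_of_dir d₂.symm d₄.symm d₆ d₁ d₅ d₃.symm
  have hD := h.not_diamond_of_dir d₃.symm d₅.symm d₆.symm d₁ d₄ d₂.symm
  have r₁ := d₁.arc_iff
  have r₂ := d₂.arc_iff
  have r₃ := d₃.arc_iff
  have r₄ := d₄.arc_iff
  have r₅ := d₅.arc_iff
  have r₆ := d₆.arc_iff
  rw [r₅] at hA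
  rw [r₁, r₃] at hB
  rw [r₂, r₃, r₄] at hC
  rw [r₂, r₃, r₅, r₆] at hD
  have key : ((G.Arc a c ↔ ¬ G.Arc b d) ∧ (G.Arc a d ↔ ¬ G.Arc b c)) ∨
      ((G.Arc a b ↔ ¬ G.Arc c d) ∧ (G.Arc a d ↔ G.Arc b c)) ∨
      ((G.Arc a b ↔ G.Arc c d) ∧ (G.Arc a c ↔ G.Arc b d)) := by
    grind
  rcases key with ⟨k, l⟩ | ⟨k, l⟩ | ⟨k, l⟩
  · exact selfDual_four_of_swap_swap hab hac had hbc hbd hcd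
      (by rw [r₅, k]) (by rw [r₂, k, not_not]) (by rw [r₄, l]) (by rw [r₃, l, not_not])
  · exact e₁ ▸ selfDual_four_of_swap_swap hac hab had hbc.symm hcd hbd
      (by rw [r₆, k]) (by rw [r₁, k, not_not]) l (by rw [r₃, r₄, l])
  · exact e₂ ▸ selfDual_four_of_swap_swap had hab hac hbd.symm hcd.symm hbc
      k (by rw [r₁, r₆, k]) l (by rw [r₂, r₅, l])

theorem IsPrechain.selfDual_of_ncard_le_four (h : G.IsPrechain) {Y : Set V} (hfin : Y.Finite)
    (hY : Y.ncard ≤ 4) : SelfDual (G.ind Y) := by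
  obtain ⟨Y, rfl⟩ := hfin.exists_finset_coe
  classical
  rw [Set.ncard_coe_finset] at hY
  obtain h0 | h1 | h2 | h3 | h4 : Y.card = 0 ∨ Y.card = 1 ∨ Y.card = 2 ∨ Y.card = 3 ∨
      Y.card = 4 := by omega
  · rw [Finset.card_eq_zero] at h0
    subst h0
    exact ⟨Equiv.refl _, fun x => absurd x.2 (Finset.notMem_empty _)⟩
  · obtain ⟨a, rfl⟩ := Finset.card_eq_one.1 h1
    rw [Finset.coe_singleton, ← Set.pair_eq_singleton]
    exact selfDual_pair a a
  · obtain ⟨a, b, -, rfl⟩ := Finset.card_eq_two.1 h2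
    rw [Finset.coe_pair]
    exact selfDual_pair a b
  · obtain ⟨a, b, c, hab, hac, hbc, rfl⟩ := Finset.card_eq_three.1 h3
    rw [Finset.coe_insert, Finset.coe_pair]
    exact h.selfDual_three hab hac hbc
  · obtain ⟨a, Z, ha, rfl, hZ⟩ := Finset.card_eq_succ.1 h4
    obtain ⟨b, c, d, hbc, hbd, hcd, rfl⟩ := Finset.card_eq_three.1 hZ
    simp only [Finset.mem_insert, Finset.mem_singleton, not_or] at ha
    rw [Finset.coe_insert, Finset.coe_insert, Finset.coe_pair]
    exact h.selfDual_four ha.1 ha.2.1 ha.2.2 hbc hbd hcd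

theorem reversible_of_cdual {D : Set V} (hc : G.IsACComponent D) (hs : ¬ SelfDual (G.ind D))
    (hi : G.IsInterval D) (hf : G.FlagDisjoint D) (h4 : Cdual (G.ind D) = 4) :
    G.Reversible D where
  comp := hc
  interval := hi
  not_selfDual := hs
  three := selfDualUpTo_of_ind fun Y hfin hY => selfDual_of_ncard_lt_cdual hfin <| by
    rw [h4]
    exact_mod_cast Nat.lt_succ_of_le hY
  four := .inr (notSeparating_of_flagDisjoint hc hf)

theorem reversible_of_isPrechain {D : Set V} (hc : G.IsACComponent D)
    (hs : ¬ SelfDual (G.ind D)) (hi : G.IsInterval D) (hp : IsPrechain (G.ind D)) :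
    G.Reversible D where
  comp := hc
  interval := hi
  not_selfDual := hs
  three := selfDualUpTo_of_ind fun _ hfin hY => hp.selfDual_of_ncard_le_four hfin (by omega)
  four := .inl (selfDualUpTo_of_ind fun _ hfin hY => hp.selfDual_of_ncard_le_four hfin hY)

end SelfDualSubdigraphs

end Dgraph

open Dgraph
/-- If a digraph satisfies L3 or L4 then it is not (≤6)-half-reconstructible. -/
theorem not_half_recon_of_L3_or_L4 {V : Type u} (G : Dgraph V)
    (h : G.CondL3 ∨ G.CondL4) : ¬ G.HalfRecon 6 := by
  rcases h with ⟨-, D, E, hne, ⟨hDc, hDs, hDi⟩, ⟨hEc, hEs, hEi⟩, h⟩ |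
    ⟨-, D, hDc, hDs, huniq, hDi, h, hiso⟩
  · rcases h with ⟨hDf, hD4, hEf, hE4⟩ | ⟨hDp, -, hEp, -⟩
    · exact not_halfRecon_of_two (reversible_of_cdual hDc hDs hDi hDf hD4)
        (reversible_of_cdual hEc hEs hEi hEf hE4) hne
    · exact not_halfRecon_of_two (reversible_of_isPrechain hDc hDs hDi hDp.1)
        (reversible_of_isPrechain hEc hEs hEi hEp.1) hne
  · have hD : G.Reversible D := by
      rcases h with ⟨hf, h4⟩ | ⟨hp, -⟩
      · exact reversible_of_cdual hDc hDs hDi hf h4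
      · exact reversible_of_isPrechain hDc hDs hDi hp.1
    exact not_halfRecon_of_unique hD (fun E hE => huniq E hE.comp hE.not_selfDual) hiso
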